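/- Let Ã be an invertible n×n real matrix, L an n×k real matrix, and R a k×n real matrix such that R·Rᵀ is invertible, and assume Â = Ã + L·R is invertible. Then the Woodbury operator W = I_k + R·Ã⁻¹·L is invertible and its condition number satisfies κ(W) ≤ (‖R†‖·‖R‖)²·κ(Â)·κ(Ã), where R† = Rᵀ(R·Rᵀ)⁻¹. -/

import Mathlib

open Matrix

/-- The spectral norm of a real matrix: the operator norm of the induced linear map
between Euclidean spaces. -/
noncomputable def specNorm {m n : ℕ} (M : Matrix (Fin m) (Fin n) ℝ) : ℝ :=
  ‖LinearMap.toContinuousLinearMap (Matrix.toEuclideanLin M)‖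

open scoped Matrix.Norms.L2Operator in
theorem specNorm_eq_l2_opNorm {m n : ℕ} (M : Matrix (Fin m) (Fin n) ℝ) : specNorm M = ‖M‖ :=
  rfl

theorem specNorm_nonneg {m n : ℕ} (M : Matrix (Fin m) (Fin n) ℝ) : 0 ≤ specNorm M :=
  norm_nonneg _

theorem specNorm_mul_le {l m n : ℕ} (M : Matrix (Fin l) (Fin m) ℝ) (N : Matrix (Fin m) (Fin n) ℝ) :
    specNorm (M * N) ≤ specNorm M * specNorm N := by
  simpa only [specNorm_eq_l2_opNorm] using Matrix.l2_opNorm_mul M N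

theorem specNorm_mul₄_le {l m n p q : ℕ} (M : Matrix (Fin l) (Fin m) ℝ)
    (N : Matrix (Fin m) (Fin n) ℝ) (P : Matrix (Fin n) (Fin p) ℝ) (Q : Matrix (Fin p) (Fin q) ℝ) :
    specNorm (M * N * P * Q) ≤ specNorm M * specNorm N * specNorm P * specNorm Q := by
  have hQ := specNorm_nonneg Q
  have hP := specNorm_nonneg P
  calc specNorm (M * N * P * Q) ≤ specNorm (M * N * P) * specNorm Q := specNorm_mul_le _ _
    _ ≤ specNorm (M * N) * specNorm P * specNorm Q := by gcongr; exact specNorm_mul_le _ _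
    _ ≤ specNorm M * specNorm N * specNorm P * specNorm Q := by gcongr; exact specNorm_mul_le _ _

/-- the Woodbury operator is invertible and its condition number
satisfies `κ(W) ≤ (‖R†‖·‖R‖)²·κ(Â)·κ(Ã)`. -/
theorem woodbury_condition_right {n k : ℕ}
    (Atil : Matrix (Fin n) (Fin n) ℝ)
    (L : Matrix (Fin n) (Fin k) ℝ) (R : Matrix (Fin k) (Fin n) ℝ)
    (hA : IsUnit Atil.det) (hR : IsUnit (R * Rᵀ).det)
    (hAhat : IsUnit (Atil + L * R).det) :
    IsUnit (1 + R * Atil⁻¹ * L).det ∧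
    specNorm (1 + R * Atil⁻¹ * L) * specNorm (1 + R * Atil⁻¹ * L)⁻¹ ≤
      (specNorm (Rᵀ * (R * Rᵀ)⁻¹) * specNorm R) ^ 2 *
        (specNorm (Atil + L * R) * specNorm (Atil + L * R)⁻¹) *
        (specNorm Atil * specNorm Atil⁻¹) := by
  have hRR : R * (Rᵀ * (R * Rᵀ)⁻¹) = 1 := by
    rw [← Matrix.mul_assoc, Matrix.mul_nonsing_inv _ hR]
  have hWR : (1 + R * Atil⁻¹ * L) * R = R * Atil⁻¹ * (Atil + L * R) := by
    rw [Matrix.mul_add, Matrix.nonsing_inv_mul_cancel_right _ _ hA, Matrix.add_mul,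
      Matrix.one_mul, Matrix.mul_assoc _ L R]
  generalize 1 + R * Atil⁻¹ * L = W at *
  generalize Rᵀ * (R * Rᵀ)⁻¹ = S at *
  generalize Atil + L * R = B at *
  have hW : W = R * Atil⁻¹ * B * S := by
    rw [← hWR, Matrix.mul_assoc, hRR, Matrix.mul_one]
  have hWinv : W * (R * B⁻¹ * Atil * S) = 1 := by
    rw [← Matrix.mul_assoc, ← Matrix.mul_assoc, ← Matrix.mul_assoc, hWR,
      Matrix.mul_nonsing_inv_cancel_right _ _ hAhat, Matrix.nonsing_inv_mul_cancel_right _ _ hA,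
      hRR]
  refine ⟨Matrix.isUnit_det_of_right_inverse hWinv, ?_⟩
  rw [Matrix.inv_eq_right_inv hWinv]
  calc specNorm W * specNorm (R * B⁻¹ * Atil * S)
      ≤ (specNorm R * specNorm Atil⁻¹ * specNorm B * specNorm S) *
        (specNorm R * specNorm B⁻¹ * specNorm Atil * specNorm S) := by
        rw [hW]
        exact mul_le_mul (specNorm_mul₄_le _ _ _ _) (specNorm_mul₄_le _ _ _ _)
          (specNorm_nonneg _) ((specNorm_nonneg _).trans (specNorm_mul₄_le _ _ _ _))
    _ = _ := by ring
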